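/- arXiv:1610.06474 — 2 statements merged into one kernel-verified Lean document; each statement's English description precedes it below -/
import Mathlib

section
/- Let $\mu$ be a Borel probability measure on $\mathbb{R}^{n+d}$ ($n\geq 0$, $d\geq 1$). Then the packing dimension of $\mu$ satisfies $\Dim\mu = \sup\{\gamma : \liminf_{r\to 0+} r^{-\gamma} G_d^{\mu}(x,r) = 0 \text{ for } \mu\text{-a.e. } x\}$, where for $x=(u,v)\in\mathbb{R}^n\times\mathbb{R}^d$, $G_d^{\mu}(x,r) = \int_{D(u,r)\times\mathbb{R}^d} \prod_{i=1}^d \min\{1, r|y_i - v_i|^{-1}\}\, d\mu(w,y)$ (with $\min\{1,0^{-1}\}=1$ and $D(u,r)$ the closed max-norm ball in $\mathbb{R}^n$). -/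
open MeasureTheory Filter
open scoped ENNReal

/-- The covering number of `E` by closed balls of radius `r`. -/
noncomputable def covN {X : Type*} [PseudoMetricSpace X] (E : Set X) (r : ℝ) : ℕ∞ :=
  sInf ((fun S : Finset X => (S.card : ℕ∞)) ''
    {S | E ⊆ ⋃ x ∈ S, Metric.closedBall x r})

/-- The upper Minkowski (box-counting) dimension of a set. -/
noncomputable def uMDim {X : Type*} [PseudoMetricSpace X] (E : Set X) : ℝ≥0∞ :=
  Filter.limsup (fun r : ℝ =>
      if covN E r = ⊤ then (⊤ : ℝ≥0∞)
      else ENNReal.ofReal (Real.log ((covN E r).toNat) / Real.log (1 / r)))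
    (nhdsWithin 0 (Set.Ioi 0))

/-- The packing dimension of a set, via countable covers. -/
noncomputable def packDim {X : Type*} [PseudoMetricSpace X] (E : Set X) : ℝ≥0∞ :=
  ⨅ (c : ℕ → Set X) (_ : E ⊆ ⋃ i, c i), ⨆ i, uMDim (c i)

/-- The packing dimension of a measure. -/
noncomputable def packDimMeasure {X : Type*} [PseudoMetricSpace X] [MeasurableSpace X]
    (μ : Measure X) : ℝ≥0∞ :=
  ⨅ (E : Set X) (_ : MeasurableSet E) (_ : 0 < μ E), packDim E


open Topology

theorem sum_inv_abs_sub_le (M : ℕ) (b : ℤ) :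
    ∑ z ∈ Finset.Icc (-(M : ℤ)) M, 3 / (|(z : ℝ) - b| + 1) ≤
      6 * (1 + Real.log (2 * M + 1)) := by
  set b' : ℤ := max (-M) (min M b) with hb'
  have hclamp : ∀ z ∈ Finset.Icc (-(M : ℤ)) M, |z - b'| ≤ |z - b| ∧ |z - b'| ≤ 2 * M := by
    intro z hz
    rw [Finset.mem_Icc] at hz
    simp only [Int.abs_eq_natAbs]
    constructor <;> omega
  have hharm : ∑ k ∈ Finset.range (2 * M + 1), (1 : ℝ) / (k + 1) ≤ 1 + Real.log (2 * M + 1) := by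
    have h := harmonic_le_one_add_log (2 * M + 1)
    simpa [harmonic] using h
  have hfib : ∀ k ∈ Finset.range (2 * M + 1),
      ∑ z ∈ Finset.Icc (-(M : ℤ)) M with (z - b').natAbs = k, 3 / (|(z : ℝ) - b'| + 1) ≤
        6 * ((1 : ℝ) / (k + 1)) := by
    intro k _
    have hsub : ((Finset.Icc (-(M : ℤ)) M).filter fun z => (z - b').natAbs = k) ⊆
        {b' + k, b' - k} := by
      intro z hz
      simp only [Finset.mem_filter, Finset.mem_insert, Finset.mem_singleton] at hz ⊢
      omega
    have hterm : ∀ z ∈ (Finset.Icc (-(M : ℤ)) M).filter (fun z => (z - b').natAbs = k),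
        3 / (|(z : ℝ) - b'| + 1) ≤ 3 / ((k : ℝ) + 1) := by
      intro z hz
      have hz' := (Finset.mem_filter.1 hz).2
      have : |(z : ℝ) - b'| = k := by
        rw [← hz', Nat.cast_natAbs]
        push_cast
        rfl
      rw [this]
    refine (Finset.sum_le_card_nsmul _ _ _ hterm).trans ?_
    rw [nsmul_eq_mul]
    have hcard : (((Finset.Icc (-(M : ℤ)) M).filter fun z => (z - b').natAbs = k).card : ℝ) ≤ 2 := by
      exact_mod_cast (Finset.card_le_card hsub).trans Finset.card_le_two
    calc _ ≤ 2 * (3 / ((k : ℝ) + 1)) := by gcongr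
      _ = _ := by ring
  calc ∑ z ∈ Finset.Icc (-(M : ℤ)) M, 3 / (|(z : ℝ) - b| + 1)
      ≤ ∑ z ∈ Finset.Icc (-(M : ℤ)) M, 3 / (|(z : ℝ) - b'| + 1) := by
        refine Finset.sum_le_sum fun z hz => ?_
        have : |(z : ℝ) - b'| ≤ |(z : ℝ) - b| := by exact_mod_cast (hclamp z hz).1
        gcongr
    _ = ∑ k ∈ Finset.range (2 * M + 1), ∑ z ∈ Finset.Icc (-(M : ℤ)) M with (z - b').natAbs = k,
          3 / (|(z : ℝ) - b'| + 1) := by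
        refine (Finset.sum_fiberwise_of_maps_to (fun z hz => ?_) _).symm
        have := (hclamp z hz).2
        rw [Int.abs_eq_natAbs] at this
        rw [Finset.mem_range]
        omega
    _ ≤ ∑ k ∈ Finset.range (2 * M + 1), 6 * ((1 : ℝ) / (k + 1)) := Finset.sum_le_sum hfib
    _ ≤ _ := by
        rw [← Finset.mul_sum]
        gcongr

/-- The index of the cell of the grid of mesh `r` that contains `x`. -/
noncomputable def gridCell {n d : ℕ} (r : ℝ) (x : (Fin n → ℝ) × (Fin d → ℝ)) :
    Fin n ⊕ Fin d → ℤ :=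
  fun i => ⌊Sum.elim x.1 x.2 i / r⌋

/-- A kernel depending only on grid cells that dominates the kernel of `G_d^μ`. -/
noncomputable def gridKernel {ι : Type*} [Fintype ι] (z b : ι → ℤ) : ℝ :=
  ∏ i, 3 / (|(z i : ℝ) - b i| + 1)

theorem gridKernel_nonneg {ι : Type*} [Fintype ι] (z b : ι → ℤ) : 0 ≤ gridKernel z b :=
  Finset.prod_nonneg fun _ _ => by positivity

theorem sum_gridKernel_le {ι : Type*} [Fintype ι] [DecidableEq ι] (M : ℕ) (b : ι → ℤ) :
    ∑ z ∈ Fintype.piFinset (fun _ : ι => Finset.Icc (-(M : ℤ)) M), gridKernel z b ≤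
      (6 * (1 + Real.log (2 * M + 1))) ^ Fintype.card ι := by
  have h := Finset.prod_univ_sum (fun _ : ι => Finset.Icc (-(M : ℤ)) M)
    (fun i z => 3 / (|(z : ℝ) - b i| + 1))
  unfold gridKernel
  rw [← h, ← Finset.card_univ, ← Finset.prod_const]
  exact Finset.prod_le_prod (fun i _ => Finset.sum_nonneg fun _ _ => by positivity)
    fun i _ => sum_inv_abs_sub_le M (b i)

theorem one_le_kernel_of_abs_sub_le {r a b : ℝ} (hr : 0 < r) (h : |a - b| ≤ r) :
    1 ≤ 3 / (|(⌊a / r⌋ : ℝ) - ⌊b / r⌋| + 1) := by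
  have h1 : |a / r - b / r| ≤ 1 := by
    rw [← sub_div, abs_div, abs_of_pos hr]
    exact (div_le_one hr).2 h
  have h2 := abs_le.1 h1
  have h3 := Int.floor_le (a / r)
  have h4 := Int.lt_floor_add_one (a / r)
  have h5 := Int.floor_le (b / r)
  have h6 := Int.lt_floor_add_one (b / r)
  rw [one_le_div (by positivity)]
  have : |(⌊a / r⌋ : ℝ) - ⌊b / r⌋| ≤ 2 := abs_le.2 ⟨by linarith, by linarith⟩
  linarith

theorem min_one_div_le_kernel {r a b : ℝ} (hr : 0 < r) (hab : b ≠ a) :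
    min 1 (r / |b - a|) ≤ 3 / (|(⌊a / r⌋ : ℝ) - ⌊b / r⌋| + 1) := by
  have hpos : 0 < |b - a| := abs_pos.2 (sub_ne_zero.2 hab)
  rcases le_total |b - a| r with h | h
  · exact (min_le_left _ _).trans (one_le_kernel_of_abs_sub_le hr (by rwa [abs_sub_comm]))
  · refine (min_le_right _ _).trans ?_
    have h1 : |a / r - b / r| = |b - a| / r := by
      rw [← sub_div, abs_div, abs_of_pos hr, abs_sub_comm]
    have h7 : 1 ≤ |b - a| / r := (one_le_div hr).2 h
    have h3 := Int.floor_le (a / r)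
    have h4 := Int.lt_floor_add_one (a / r)
    have h5 := Int.floor_le (b / r)
    have h6 := Int.lt_floor_add_one (b / r)
    have h8 : |(⌊a / r⌋ : ℝ) - ⌊b / r⌋| ≤ |b - a| / r + 1 := by
      rw [← h1]
      have h9 := neg_abs_le (a / r - b / r)
      have h10 := le_abs_self (a / r - b / r)
      exact abs_le.2 ⟨by linarith, by linarith⟩
    have h11 : r / |b - a| = 3 / (3 * (|b - a| / r)) := by
      field_simp
    rw [h11]
    gcongr
    linarith

theorem measurable_gridKernel {n d : ℕ} (z : Fin n ⊕ Fin d → ℤ) (r : ℝ) :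
    Measurable fun p : (Fin n → ℝ) × (Fin d → ℝ) => gridKernel z (gridCell r p) := by
  unfold gridKernel gridCell
  refine Finset.measurable_prod _ fun i _ => ?_
  have h : Measurable fun p : (Fin n → ℝ) × (Fin d → ℝ) => Sum.elim p.1 p.2 i := by
    rcases i with i | i <;> simp only [Sum.elim_inl, Sum.elim_inr] <;> fun_prop
  have h2 : Measurable fun p : (Fin n → ℝ) × (Fin d → ℝ) =>
      ((⌊Sum.elim p.1 p.2 i / r⌋ : ℤ) : ℝ) :=
    (measurable_from_top (f := fun k : ℤ => (k : ℝ))).comp (h.div_const r).floor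
  have h3 : Measurable fun p : (Fin n → ℝ) × (Fin d → ℝ) =>
      |(z i : ℝ) - ((⌊Sum.elim p.1 p.2 i / r⌋ : ℤ) : ℝ)| := (measurable_const.sub h2).abs
  exact measurable_const.div (h3.add_const 1)

open scoped Classical in
/-- The kernel average `G_d^μ(x, r)`. -/
noncomputable def kernelAverage {n d : ℕ} (μ : Measure ((Fin n → ℝ) × (Fin d → ℝ)))
    (x : (Fin n → ℝ) × (Fin d → ℝ)) (r : ℝ) : ℝ≥0∞ :=
  ∫⁻ p in {p : (Fin n → ℝ) × (Fin d → ℝ) | ‖p.1 - x.1‖ ≤ r},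
    ∏ i, (if p.2 i = x.2 i then 1 else ENNReal.ofReal (min 1 (r / |p.2 i - x.2 i|))) ∂μ

theorem kernelAverage_le {n d : ℕ} (μ : Measure ((Fin n → ℝ) × (Fin d → ℝ)))
    (x : (Fin n → ℝ) × (Fin d → ℝ)) {r : ℝ} (hr : 0 < r) :
    kernelAverage μ x r ≤
      ∫⁻ p, ENNReal.ofReal (gridKernel (gridCell r x) (gridCell r p)) ∂μ := by
  refine le_trans (setLIntegral_mono (measurable_gridKernel _ r).ennreal_ofReal
    fun p hp => ?_) (setLIntegral_le_lintegral _ _)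
  simp only [Set.mem_ofPred_eq] at hp
  unfold gridKernel gridCell
  rw [Fintype.prod_sum_type]
  simp only [Sum.elim_inl, Sum.elim_inr]
  have h1 : 1 ≤ ∏ i : Fin n, 3 / (|(⌊x.1 i / r⌋ : ℝ) - ⌊p.1 i / r⌋| + 1) := by
    refine Finset.prod_induction _ (1 ≤ ·) (fun _ _ => one_le_mul_of_one_le_of_one_le) le_rfl
      fun i _ => one_le_kernel_of_abs_sub_le hr ?_
    have := (norm_le_pi_norm (p.1 - x.1) i).trans hp
    rw [abs_sub_comm]
    simpa using this
  have h2 : 0 ≤ ∏ i : Fin d, 3 / (|(⌊x.2 i / r⌋ : ℝ) - ⌊p.2 i / r⌋| + 1) :=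
    Finset.prod_nonneg fun _ _ => by positivity
  refine le_trans ?_ (ENNReal.ofReal_le_ofReal (le_mul_of_one_le_left h2 h1))
  rw [ENNReal.ofReal_prod_of_nonneg fun _ _ => by positivity]
  refine Finset.prod_le_prod' fun i _ => ?_
  split_ifs with h
  · rw [← ENNReal.ofReal_one]
    exact ENNReal.ofReal_le_ofReal
      (one_le_kernel_of_abs_sub_le hr (by simpa [h] using hr.le))
  · exact ENNReal.ofReal_le_ofReal (min_one_div_le_kernel hr h)

theorem measure_closedBall_le_kernelAverage {n d : ℕ}
    (μ : Measure ((Fin n → ℝ) × (Fin d → ℝ))) (x : (Fin n → ℝ) × (Fin d → ℝ)) (r : ℝ) :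
    μ (Metric.closedBall x r) ≤ kernelAverage μ x r := by
  have hsub : Metric.closedBall x r ⊆
      {p : (Fin n → ℝ) × (Fin d → ℝ) | ‖p.1 - x.1‖ ≤ r} := fun p hp => by
    rw [mem_closedBall_iff_norm] at hp
    exact (norm_fst_le (p - x)).trans hp
  rw [← setLIntegral_one]
  refine le_trans (setLIntegral_mono' Metric.isClosed_closedBall.measurableSet fun p hp => ?_)
    (lintegral_mono_set hsub)
  refine Finset.one_le_prod'' fun i => ?_
  split_ifs with h
  · exact le_rfl
  · rw [← ENNReal.ofReal_one]
    refine ENNReal.ofReal_le_ofReal (le_min le_rfl ?_)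
    rw [mem_closedBall_iff_norm] at hp
    have := (norm_le_pi_norm (p - x).2 i).trans ((norm_snd_le (p - x)).trans hp)
    exact (one_le_div (abs_pos.2 (sub_ne_zero.2 h))).2 (by simpa using this)

theorem dist_le_of_gridCell_eq {n d : ℕ} {r : ℝ} (hr : 0 < r)
    {x y : (Fin n → ℝ) × (Fin d → ℝ)} (h : gridCell r x = gridCell r y) : dist x y ≤ r := by
  have key : ∀ i, |Sum.elim x.1 x.2 i - Sum.elim y.1 y.2 i| ≤ r := fun i => by
    have h1 := (Int.abs_sub_lt_one_of_floor_eq_floor (congrFun h i)).le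
    rw [← sub_div, abs_div, abs_of_pos hr] at h1
    exact (div_le_one hr).1 h1
  rw [Prod.dist_eq, max_le_iff, dist_pi_le_iff hr.le, dist_pi_le_iff hr.le]
  exact ⟨fun i => key (Sum.inl i), fun i => key (Sum.inr i)⟩

theorem gridCell_mem_piFinset {n d : ℕ} {r R : ℝ} (hr : 0 < r)
    {x : (Fin n → ℝ) × (Fin d → ℝ)} (hx : ‖x‖ ≤ R) :
    gridCell r x ∈ Fintype.piFinset
      (fun _ : Fin n ⊕ Fin d => Finset.Icc (-((⌈R / r⌉₊ : ℕ) : ℤ)) (⌈R / r⌉₊ : ℕ)) := by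
  rw [Fintype.mem_piFinset]
  intro i
  have h : |Sum.elim x.1 x.2 i| ≤ R := by
    rcases i with i | i
    · exact (norm_le_pi_norm x.1 i).trans ((norm_fst_le x).trans hx)
    · exact (norm_le_pi_norm x.2 i).trans ((norm_snd_le x).trans hx)
  have h1 : |Sum.elim x.1 x.2 i / r| ≤ (⌈R / r⌉₊ : ℕ) := by
    rw [abs_div, abs_of_pos hr]
    exact (div_le_div_of_nonneg_right h hr.le).trans (Nat.le_ceil _)
  obtain ⟨h2, h3⟩ := abs_le.1 h1
  unfold gridCell
  rw [Finset.mem_Icc, Int.le_floor]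
  refine ⟨by push_cast; exact h2, ?_⟩
  have := (Int.floor_le (Sum.elim x.1 x.2 i / r)).trans h3
  exact_mod_cast this

theorem covN_closure_le_card {X : Type*} [PseudoMetricSpace X] {E : Set X} {r : ℝ}
    {S : Finset X} (h : E ⊆ ⋃ x ∈ S, Metric.closedBall x r) : covN (closure E) r ≤ S.card := by
  refine sInf_le ⟨S, ?_, rfl⟩
  exact closure_minimal h (S.finite_toSet.isClosed_biUnion fun _ _ => Metric.isClosed_closedBall)

theorem exists_finset_covN_le {n d : ℕ} {r R : ℝ} (hr : 0 < r)
    {E : Set ((Fin n → ℝ) × (Fin d → ℝ))} (hE : ∀ x ∈ E, ‖x‖ ≤ R) :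
    ∃ S : Finset ((Fin n → ℝ) × (Fin d → ℝ)), (∀ x ∈ S, x ∈ E) ∧
      Set.InjOn (gridCell r) (S : Set ((Fin n → ℝ) × (Fin d → ℝ))) ∧
      covN (closure E) r ≤ S.card := by
  obtain ⟨s, hsE, hbij⟩ := E.exists_subset_bijOn (gridCell r)
  have hfin : s.Finite := by
    refine Set.Finite.of_finite_image ?_ hbij.injOn
    refine (Finset.finite_toSet (Fintype.piFinset (fun _ : Fin n ⊕ Fin d =>
      Finset.Icc (-((⌈R / r⌉₊ : ℕ) : ℤ)) (⌈R / r⌉₊ : ℕ)))).subset ?_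
    rintro _ ⟨x, hx, rfl⟩
    exact gridCell_mem_piFinset hr (hE x (hsE hx))
  refine ⟨hfin.toFinset, fun x hx => hsE (hfin.mem_toFinset.1 hx), by simpa using hbij.injOn, ?_⟩
  refine covN_closure_le_card fun x hx => ?_
  obtain ⟨y, hy, hyx⟩ := hbij.surjOn (Set.mem_image_of_mem _ hx)
  simp only [Set.mem_iUnion]
  exact ⟨y, hfin.mem_toFinset.2 hy, Metric.mem_closedBall.2 (dist_le_of_gridCell_eq hr hyx.symm)⟩

theorem sum_kernelAverage_le {n d : ℕ} (μ : Measure ((Fin n → ℝ) × (Fin d → ℝ)))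
    [IsProbabilityMeasure μ] {r R : ℝ} (hr : 0 < r)
    {S : Finset ((Fin n → ℝ) × (Fin d → ℝ))} (hS : ∀ x ∈ S, ‖x‖ ≤ R)
    (hinj : Set.InjOn (gridCell r) (S : Set ((Fin n → ℝ) × (Fin d → ℝ)))) :
    ∑ x ∈ S, kernelAverage μ x r ≤
      ENNReal.ofReal ((6 * (1 + Real.log (2 * (⌈R / r⌉₊ : ℕ) + 1))) ^ (n + d)) := by
  calc ∑ x ∈ S, kernelAverage μ x r
      ≤ ∑ x ∈ S, ∫⁻ p, ENNReal.ofReal (gridKernel (gridCell r x) (gridCell r p)) ∂μ :=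
        Finset.sum_le_sum fun x _ => kernelAverage_le μ x hr
    _ = ∫⁻ p, ∑ x ∈ S, ENNReal.ofReal (gridKernel (gridCell r x) (gridCell r p)) ∂μ :=
        (lintegral_finsetSum _ fun x _ => (measurable_gridKernel _ r).ennreal_ofReal).symm
    _ ≤ ∫⁻ _, ENNReal.ofReal ((6 * (1 + Real.log (2 * (⌈R / r⌉₊ : ℕ) + 1))) ^ (n + d)) ∂μ := by
        refine lintegral_mono fun p => ?_
        rw [← ENNReal.ofReal_sum_of_nonneg fun _ _ => gridKernel_nonneg _ _]
        refine ENNReal.ofReal_le_ofReal ?_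
        rw [← Finset.sum_image (f := fun z => gridKernel z (gridCell r p)) hinj]
        have h := sum_gridKernel_le ⌈R / r⌉₊ (gridCell r p)
        simp only [Fintype.card_sum, Fintype.card_fin] at h
        refine le_trans (Finset.sum_le_sum_of_subset_of_nonneg ?_
          fun _ _ _ => gridKernel_nonneg _ _) h
        intro z hz
        obtain ⟨x, hx, rfl⟩ := Finset.mem_image.1 hz
        exact gridCell_mem_piFinset hr (hS x hx)
    _ = _ := by simp

theorem two_mul_ceil_add_one_le {R r : ℝ} (hR : 0 ≤ R) (hr0 : 0 < r) (hr1 : r < 1) :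
    2 * (⌈R / r⌉₊ : ℝ) + 1 ≤ (2 * R + 3) * r⁻¹ := by
  have h1 := (Nat.ceil_lt_add_one (div_nonneg hR hr0.le)).le
  have h2 : 1 ≤ r⁻¹ := (one_le_inv₀ hr0).2 hr1.le
  rw [div_eq_mul_inv] at h1 ⊢
  linarith

theorem uMDim_le_of_covN_le {X : Type*} [PseudoMetricSpace X] {E : Set X} {C s : ℝ}
    (hC : 0 < C) (hs : 0 ≤ s)
    (h : ∀ᶠ r in 𝓝[>] (0 : ℝ), ∃ N : ℕ, covN E r ≤ N ∧ (N : ℝ) ≤ C * r ^ (-s)) :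
    uMDim E ≤ ENNReal.ofReal s := by
  have hlog : Tendsto (fun r : ℝ => Real.log (1 / r)) (𝓝[>] 0) atTop := by
    simp_rw [one_div]
    exact Real.tendsto_log_atTop.comp tendsto_inv_nhdsGT_zero
  have hlim : Tendsto (fun r : ℝ => ENNReal.ofReal (|Real.log C| / Real.log (1 / r) + s))
      (𝓝[>] 0) (𝓝 (ENNReal.ofReal s)) := by
    refine ENNReal.tendsto_ofReal ?_
    simpa using (hlog.const_div_atTop |Real.log C|).add_const s
  unfold uMDim
  rw [← hlim.limsup_eq]
  refine limsup_le_limsup ?_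
  filter_upwards [h, hlog.eventually_gt_atTop 0, self_mem_nhdsWithin] with r ⟨N, hN, hNC⟩ hl hr
  have hr : 0 < r := hr
  have htop : covN E r ≠ ⊤ := ne_top_of_le_ne_top (ENat.natCast_ne_top N) hN
  rw [if_neg htop]
  refine ENNReal.ofReal_le_ofReal ?_
  have hcov : ((covN E r).toNat : ℝ) ≤ C * r ^ (-s) := by
    refine le_trans ?_ hNC
    exact_mod_cast ENat.toNat_le_of_le_natCast hN
  rw [div_le_iff₀ hl, add_mul, div_mul_cancel₀ _ hl.ne']
  rcases Nat.eq_zero_or_pos (covN E r).toNat with h0 | h0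
  · rw [h0]
    simp only [Nat.cast_zero, Real.log_zero]
    positivity
  · refine (Real.log_le_log (by exact_mod_cast h0) hcov).trans ?_
    rw [Real.log_mul hC.ne' (Real.rpow_pos_of_pos hr _).ne', Real.log_rpow hr, one_div,
      Real.log_inv]
    linarith [le_abs_self (Real.log C)]

theorem packDimMeasure_le_uMDim {X : Type*} [PseudoMetricSpace X] [MeasurableSpace X]
    {μ : Measure X} {E : Set X} (hE : MeasurableSet E) (hμ : 0 < μ E) :
    packDimMeasure μ ≤ uMDim E := by
  refine (iInf₂_le E hE).trans ((iInf_le _ hμ).trans ?_)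
  refine (iInf₂_le (fun _ : ℕ => E) (Set.subset_iUnion (fun _ : ℕ => E) 0)).trans ?_
  exact iSup_le fun _ => le_rfl

theorem covN_le_of_uMDim_lt {X : Type*} [PseudoMetricSpace X] {E : Set X} {s : ℝ}
    (h : uMDim E < ENNReal.ofReal s) :
    ∀ᶠ r in 𝓝[>] (0 : ℝ), ∃ S : Finset X,
      E ⊆ ⋃ x ∈ S, Metric.closedBall x r ∧ (S.card : ℝ) ≤ r ^ (-s) := by
  have hs : 0 < s := ENNReal.ofReal_pos.1 (pos_of_gt h)
  filter_upwards [eventually_lt_of_limsup_lt h, Ioo_mem_nhdsGT one_pos] with r hr hr01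
  by_cases htop : covN E r = ⊤
  · rw [if_pos htop] at hr
    exact absurd hr not_top_lt
  rw [if_neg htop, ENNReal.ofReal_lt_ofReal_iff hs] at hr
  have hne : ((fun S : Finset X => (S.card : ℕ∞)) ''
      {S | E ⊆ ⋃ x ∈ S, Metric.closedBall x r}).Nonempty := by
    rw [Set.nonempty_iff_ne_empty]
    intro h0
    exact htop (by rw [covN, h0, sInf_empty])
  obtain ⟨S, hS, hcard⟩ := csInf_mem hne
  refine ⟨S, hS, ?_⟩
  have hcov : covN E r = S.card := hcard.symm
  rw [hcov, ENat.toNat_natCast] at hr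
  have hl : 0 < Real.log (1 / r) := Real.log_pos ((one_lt_div hr01.1).2 hr01.2)
  rw [div_lt_iff₀ hl, one_div, Real.log_inv] at hr
  rcases Nat.eq_zero_or_pos S.card with h0 | h0
  · rw [h0]
    simpa using Real.rpow_nonneg hr01.1.le _
  · rw [← Real.log_le_log_iff (by exact_mod_cast h0) (Real.rpow_pos_of_pos hr01.1 _),
      Real.log_rpow hr01.1]
    linarith

theorem exists_dyadic_between {r : ℝ} {K : ℕ} (hr : 0 < r) (hrK : r < (1 / 2) ^ K) :
    ∃ k, K ≤ k ∧ 2 * (1 / 2 : ℝ) ^ k ≤ r ∧ r ≤ 4 * (1 / 2) ^ k := by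
  have hK : (1 / 2 : ℝ) ^ K ≤ 1 := pow_le_one₀ (by norm_num) (by norm_num)
  obtain ⟨m, hm1, hm2⟩ := exists_nat_pow_near_of_lt_one (x := r / 2) (y := (1 / 2 : ℝ))
    (by linarith) (by linarith) (by norm_num) (by norm_num)
  refine ⟨m + 1, ?_, by linarith, by rw [pow_succ]; linarith⟩
  have : (1 / 2 : ℝ) ^ (m + 1) < (1 / 2) ^ K := by linarith
  exact ((pow_lt_pow_iff_right_of_lt_one₀ (by norm_num) (by norm_num)).1 this).le

theorem measure_small_ball_le {X : Type*} [PseudoMetricSpace X] [MeasurableSpace X]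
    (μ : Measure X) {A : Set X} {r : ℝ} {t : ℝ≥0∞} {S : Finset X}
    (hS : A ⊆ ⋃ x ∈ S, Metric.closedBall x r) :
    μ {x ∈ A | μ (Metric.closedBall x (2 * r)) ≤ t} ≤ S.card * t := by
  set B := {x ∈ A | μ (Metric.closedBall x (2 * r)) ≤ t} with hB
  have hcov : B ⊆ ⋃ y ∈ S, (B ∩ Metric.closedBall y r) := fun x hx => by
    obtain ⟨y, hy, hxy⟩ := Set.mem_iUnion₂.1 (hS hx.1)
    exact Set.mem_iUnion₂.2 ⟨y, hy, hx, hxy⟩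
  refine (measure_mono hcov).trans ((measure_biUnion_finset_le _ _).trans ?_)
  rw [← nsmul_eq_mul]
  refine Finset.sum_le_card_nsmul _ _ _ fun y _ => ?_
  rcases (B ∩ Metric.closedBall y r).eq_empty_or_nonempty with h0 | ⟨x, hxB, hxy⟩
  · simp [h0]
  · refine (measure_mono ?_).trans hxB.2
    intro z hz
    have h1 := Metric.mem_closedBall.1 hz.2
    have h2 := Metric.mem_closedBall'.1 hxy
    exact Metric.mem_closedBall.2 ((dist_triangle z y x).trans (by linarith))

theorem ae_eventually_lt_measure_closedBall {X : Type*} [PseudoMetricSpace X]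
    [MeasurableSpace X] (μ : Measure X) {A : Set X} {s γ : ℝ}
    (hsγ : s < γ) (hA : uMDim A < ENNReal.ofReal s) :
    ∀ᵐ x ∂μ, x ∈ A → ∀ᶠ k : ℕ in atTop,
      ENNReal.ofReal (((1 / 2 : ℝ) ^ k) ^ γ) <
        μ (Metric.closedBall x (2 * (1 / 2 : ℝ) ^ k)) := by
  have hpow : Tendsto (fun k : ℕ => (1 / 2 : ℝ) ^ k) atTop (𝓝[>] 0) :=
    tendsto_pow_atTop_nhdsWithin_zero_of_lt_one (by norm_num) (by norm_num)
  obtain ⟨K, hK⟩ := eventually_atTop.1 (hpow.eventually (covN_le_of_uMDim_lt hA))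
  set q : ℝ := (1 / 2 : ℝ) ^ (γ - s) with hq
  have hq0 : 0 ≤ q := by positivity
  have hq1 : q < 1 := Real.rpow_lt_one (by norm_num) (by norm_num) (by linarith)
  have hbad : ∀ k ≥ K, μ {x ∈ A | μ (Metric.closedBall x (2 * (1 / 2 : ℝ) ^ k)) ≤
      ENNReal.ofReal (((1 / 2 : ℝ) ^ k) ^ γ)} ≤ ENNReal.ofReal (q ^ k) := by
    intro k hk
    obtain ⟨S, hS, hcard⟩ := hK k hk
    refine (measure_small_ball_le μ hS).trans ?_
    rw [← ENNReal.ofReal_natCast, ← ENNReal.ofReal_mul (Nat.cast_nonneg _)]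
    refine ENNReal.ofReal_le_ofReal ?_
    have hp : (0 : ℝ) < (1 / 2) ^ k := by positivity
    calc (S.card : ℝ) * ((1 / 2 : ℝ) ^ k) ^ γ
        ≤ ((1 / 2 : ℝ) ^ k) ^ (-s) * ((1 / 2 : ℝ) ^ k) ^ γ := by gcongr
      _ = q ^ k := by
        rw [← Real.rpow_add hp, hq, ← Real.rpow_natCast, ← Real.rpow_natCast,
          ← Real.rpow_mul (by norm_num), ← Real.rpow_mul (by norm_num)]
        ring_nf
  have hsum : ∑' k, μ {x ∈ A | μ (Metric.closedBall x (2 * (1 / 2 : ℝ) ^ (k + K))) ≤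
      ENNReal.ofReal (((1 / 2 : ℝ) ^ (k + K)) ^ γ)} ≠ ⊤ := by
    refine ne_top_of_le_ne_top ?_ (ENNReal.tsum_le_tsum fun k => hbad (k + K) (by omega))
    exact ((summable_nat_add_iff K).2
      (summable_geometric_of_lt_one hq0 hq1)).tsum_ofReal_ne_top
  filter_upwards [ae_eventually_notMem hsum] with x hx hxA
  obtain ⟨N, hN⟩ := eventually_atTop.1 hx
  refine eventually_atTop.2 ⟨N + K, fun k hk => not_le.1 fun h => hN (k - K) (by omega) ?_⟩
  rw [Nat.sub_add_cancel (by omega : K ≤ k)]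
  exact ⟨hxA, h⟩

theorem ofReal_le_packDimMeasure {X : Type*} [PseudoMetricSpace X] [MeasurableSpace X]
    {μ : Measure X} {γ : ℝ}
    (h : ∀ᵐ x ∂μ, liminf (fun r : ℝ => ENNReal.ofReal (r ^ (-γ)) * μ (Metric.closedBall x r))
      (𝓝[>] 0) = 0) :
    ENNReal.ofReal γ ≤ packDimMeasure μ := by
  refine le_iInf₂ fun E _ => le_iInf fun hμE => le_iInf₂ fun c hc => ?_
  by_contra! hlt
  have hγ : 0 < γ := ENNReal.ofReal_pos.1 (pos_of_gt hlt)
  obtain ⟨s, hs0, hs1, hs2⟩ := ENNReal.lt_iff_exists_real_btwn.1 hlt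
  have hsγ : s < γ := (ENNReal.ofReal_lt_ofReal_iff hγ).1 hs2
  have hpos : μ (⋃ i, c i) ≠ 0 := (hμE.trans_le (measure_mono hc)).ne'
  obtain ⟨i, hi⟩ : ∃ i, μ (c i) ≠ 0 := by
    by_contra! h0
    exact hpos (measure_iUnion_null h0)
  have hci : uMDim (c i) < ENNReal.ofReal s := (le_iSup (fun i => uMDim (c i)) i).trans_lt hs1
  refine hi ?_
  rw [measure_eq_zero_iff_ae_notMem]
  filter_upwards [h, ae_eventually_lt_measure_closedBall μ hsγ hci] with x hx0 hx hxA
  obtain ⟨K, hK⟩ := eventually_atTop.1 (hx hxA)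
  have hle : ENNReal.ofReal (4 ^ (-γ)) ≤ liminf (fun r : ℝ =>
      ENNReal.ofReal (r ^ (-γ)) * μ (Metric.closedBall x r)) (𝓝[>] 0) := by
    refine le_liminf_of_le (by isBoundedDefault) ?_
    filter_upwards [Ioo_mem_nhdsGT (show (0 : ℝ) < (1 / 2) ^ K by positivity)] with r hr
    obtain ⟨k, hk, hk1, hk2⟩ := exists_dyadic_between hr.1 hr.2
    have hp : (0 : ℝ) < (1 / 2) ^ k := by positivity
    calc ENNReal.ofReal (4 ^ (-γ))
        = ENNReal.ofReal ((4 * (1 / 2) ^ k) ^ (-γ)) *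
            ENNReal.ofReal (((1 / 2 : ℝ) ^ k) ^ γ) := by
          rw [← ENNReal.ofReal_mul (by positivity),
            Real.mul_rpow (by norm_num) hp.le, mul_assoc, ← Real.rpow_add hp]
          simp
      _ ≤ _ := by
          refine mul_le_mul' (ENNReal.ofReal_le_ofReal ?_)
            ((hK k hk).le.trans (measure_mono (Metric.closedBall_subset_closedBall hk1)))
          exact Real.rpow_le_rpow_of_nonpos hr.1 hk2 (by linarith)
  rw [hx0] at hle
  exact (ENNReal.ofReal_pos.2 (by positivity : (0 : ℝ) < 4 ^ (-γ))).not_ge hle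

theorem packDimMeasure_lt_top {n d : ℕ} (μ : Measure ((Fin n → ℝ) × (Fin d → ℝ)))
    [IsProbabilityMeasure μ] : packDimMeasure μ < ⊤ := by
  obtain ⟨R, hR⟩ : ∃ R : ℕ, 0 < μ (Metric.closedBall 0 R) := by
    by_contra! h
    have h0 : μ (⋃ R : ℕ, Metric.closedBall 0 (R : ℝ)) = 0 :=
      measure_iUnion_null fun R => le_antisymm (h R) zero_le
    rw [Metric.iUnion_closedBall_nat] at h0
    simp at h0
  refine (packDimMeasure_le_uMDim Metric.isClosed_closedBall.measurableSet hR).trans_lt ?_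
  refine (uMDim_le_of_covN_le (C := (2 * R + 3) ^ (n + d)) (s := (n + d : ℕ)) (by positivity)
    (by positivity) ?_).trans_lt ENNReal.ofReal_lt_top
  filter_upwards [Ioo_mem_nhdsGT one_pos] with r hr
  obtain ⟨S, hS, hinj, hcov⟩ := exists_finset_covN_le (R := R) hr.1
    (E := Metric.closedBall (0 : (Fin n → ℝ) × (Fin d → ℝ)) R)
    fun x hx => by simpa using hx
  rw [Metric.isClosed_closedBall.closure_eq] at hcov
  refine ⟨S.card, hcov, ?_⟩
  have hcard : S.card ≤ (2 * ⌈(R : ℝ) / r⌉₊ + 1) ^ (n + d) := by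
    have := Finset.card_le_card_of_injOn (gridCell r) (s := S)
      (t := Fintype.piFinset (fun _ : Fin n ⊕ Fin d =>
        Finset.Icc (-((⌈(R : ℝ) / r⌉₊ : ℕ) : ℤ)) (⌈(R : ℝ) / r⌉₊ : ℕ)))
      (fun x hx => gridCell_mem_piFinset hr.1 (by simpa using hS x hx)) hinj
    rw [Fintype.card_piFinset] at this
    simp only [Int.card_Icc, Finset.prod_const, Finset.card_univ, Fintype.card_sum,
      Fintype.card_fin] at this
    convert this using 2
    omega
  rw [Real.rpow_neg hr.1.le, Real.rpow_natCast, ← inv_pow, ← mul_pow]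
  calc (S.card : ℝ) ≤ (2 * (⌈(R : ℝ) / r⌉₊ : ℝ) + 1) ^ (n + d) := by exact_mod_cast hcard
    _ ≤ _ := by
      gcongr
      exact two_mul_ceil_add_one_le (Nat.cast_nonneg R) hr.1 hr.2

theorem exists_log_pow_le_rpow {m : ℕ} (hm : 0 < m) {R δ : ℝ} (hR : 0 ≤ R) (hδ : 0 < δ) :
    ∃ C > 0, ∀ r : ℝ, 0 < r → r < 1 →
      (6 * (1 + Real.log (2 * (⌈R / r⌉₊ : ℕ) + 1))) ^ m ≤ C * r ^ (-δ) := by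
  have hm' : (0 : ℝ) < m := by exact_mod_cast hm
  set ε := δ / m with hε
  have hε0 : 0 < ε := by positivity
  set A : ℝ := 6 * (1 + (2 * R + 3) ^ ε / ε) with hA
  refine ⟨A ^ m, by positivity, fun r hr0 hr1 => ?_⟩
  have hpow : (r ^ (-ε)) ^ m = r ^ (-δ) := by
    rw [← Real.rpow_natCast, ← Real.rpow_mul hr0.le, hε]
    congr 1
    field_simp
  have hone : 1 ≤ r ^ (-ε) := Real.one_le_rpow_of_pos_of_le_one_of_nonpos hr0 hr1.le (by linarith)
  have hx : (1 : ℝ) ≤ 2 * (⌈R / r⌉₊ : ℕ) + 1 := by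
    have : (0 : ℝ) ≤ (⌈R / r⌉₊ : ℕ) := Nat.cast_nonneg _
    linarith
  have hlog : Real.log (2 * (⌈R / r⌉₊ : ℕ) + 1) ≤ (2 * R + 3) ^ ε / ε * r ^ (-ε) := by
    refine (Real.log_le_rpow_div (by linarith) hε0).trans ?_
    rw [div_mul_eq_mul_div, Real.rpow_neg hr0.le, ← Real.inv_rpow hr0.le,
      ← Real.mul_rpow (by linarith) (by positivity)]
    gcongr
    exact two_mul_ceil_add_one_le hR hr0 hr1
  rw [← hpow, ← mul_pow]
  have := Real.log_nonneg hx
  refine pow_le_pow_left₀ (by positivity) ?_ m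
  rw [hA]
  linarith

theorem uMDim_closure_le_of_le_kernelAverage {n d : ℕ} (hd : 0 < d)
    (μ : Measure ((Fin n → ℝ) × (Fin d → ℝ))) [IsProbabilityMeasure μ]
    {E : Set ((Fin n → ℝ) × (Fin d → ℝ))} {R ρ c γ δ : ℝ} (hR : 0 ≤ R) (hρ : 0 < ρ) (hc : 0 < c)
    (hγ : 0 ≤ γ) (hδ : 0 < δ) (hER : ∀ x ∈ E, ‖x‖ ≤ R)
    (hE : ∀ x ∈ E, ∀ r ∈ Set.Ioo 0 ρ,
      ENNReal.ofReal c ≤ ENNReal.ofReal (r ^ (-γ)) * kernelAverage μ x r) :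
    uMDim (closure E) ≤ ENNReal.ofReal (γ + δ) := by
  obtain ⟨C, hC, hCr⟩ := exists_log_pow_le_rpow (Nat.add_pos_right n hd) hR hδ
  refine uMDim_le_of_covN_le (C := C / c) (by positivity) (by positivity) ?_
  filter_upwards [Ioo_mem_nhdsGT hρ, Ioo_mem_nhdsGT one_pos] with r hrρ hr
  obtain ⟨S, hS, hinj, hcov⟩ := exists_finset_covN_le hr.1 hER
  refine ⟨S.card, hcov, ?_⟩
  have h1 : (S.card : ℝ≥0∞) * ENNReal.ofReal c ≤
      ENNReal.ofReal (r ^ (-γ) * (C * r ^ (-δ))) := by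
    calc (S.card : ℝ≥0∞) * ENNReal.ofReal c
        ≤ ∑ x ∈ S, ENNReal.ofReal (r ^ (-γ)) * kernelAverage μ x r := by
          rw [← nsmul_eq_mul]
          exact Finset.card_nsmul_le_sum _ _ _ fun x hx => hE x (hS x hx) r hrρ
      _ = ENNReal.ofReal (r ^ (-γ)) * ∑ x ∈ S, kernelAverage μ x r := by rw [Finset.mul_sum]
      _ ≤ _ := by
          rw [ENNReal.ofReal_mul (Real.rpow_nonneg hr.1.le _)]
          gcongr
          exact (sum_kernelAverage_le μ hr.1 (fun x hx => hER x (hS x hx)) hinj).trans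
            (ENNReal.ofReal_le_ofReal (hCr r hr.1 hr.2))
  have hpos : 0 ≤ r ^ (-γ) * (C * r ^ (-δ)) :=
    mul_nonneg (Real.rpow_nonneg hr.1.le _) (mul_nonneg hC.le (Real.rpow_nonneg hr.1.le _))
  rw [← ENNReal.ofReal_natCast, ← ENNReal.ofReal_mul (Nat.cast_nonneg _),
    ENNReal.ofReal_le_ofReal_iff hpos] at h1
  rw [div_mul_eq_mul_div, le_div_iff₀ hc, neg_add, Real.rpow_add hr.1]
  linarith

theorem packDimMeasure_le_of_not_ae_liminf_eq_zero {n d : ℕ} (hd : 0 < d)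
    (μ : Measure ((Fin n → ℝ) × (Fin d → ℝ))) [IsProbabilityMeasure μ] {γ δ : ℝ}
    (hγ : 0 ≤ γ) (hδ : 0 < δ)
    (h : ¬ ∀ᵐ x ∂μ, liminf (fun r : ℝ => ENNReal.ofReal (r ^ (-γ)) * kernelAverage μ x r)
      (𝓝[>] 0) = 0) :
    packDimMeasure μ ≤ ENNReal.ofReal (γ + δ) := by
  set E : ℕ → Set ((Fin n → ℝ) × (Fin d → ℝ)) := fun k =>
    {x | ‖x‖ ≤ k ∧ ∀ r ∈ Set.Ioo (0 : ℝ) (1 / (k + 1)),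
      ENNReal.ofReal (1 / (k + 1)) ≤ ENNReal.ofReal (r ^ (-γ)) * kernelAverage μ x r} with hE
  obtain ⟨k, hk⟩ : ∃ k, μ (E k) ≠ 0 := by
    by_contra! h0
    refine h ?_
    have hae := measure_eq_zero_iff_ae_notMem.1 (measure_iUnion_null h0)
    filter_upwards [hae] with x hx
    by_contra hne
    refine hx ?_
    obtain ⟨ε, -, hε0, hε⟩ := ENNReal.lt_iff_exists_real_btwn.1 (pos_iff_ne_zero.2 hne)
    obtain ⟨ρ, hρ, hsub⟩ := mem_nhdsGT_iff_exists_Ioo_subset.1 (eventually_lt_of_lt_liminf hε)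
    obtain ⟨a, ha⟩ := exists_nat_one_div_lt (ENNReal.ofReal_pos.1 hε0)
    obtain ⟨b, hb⟩ := exists_nat_one_div_lt (show (0 : ℝ) < ρ from hρ)
    obtain ⟨c, hc⟩ := exists_nat_ge ‖x‖
    set k := max a (max b c)
    have hak : (a : ℝ) ≤ k := by exact_mod_cast le_max_left _ _
    have hbk : (b : ℝ) ≤ k := by exact_mod_cast (le_max_left _ _).trans (le_max_right _ _)
    have hck : (c : ℝ) ≤ k := by exact_mod_cast (le_max_right _ _).trans (le_max_right _ _)
    refine Set.mem_iUnion.2 ⟨k, hc.trans hck, fun r hr => ?_⟩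
    have h1 : (1 : ℝ) / (k + 1) ≤ 1 / (a + 1) := by gcongr
    have h2 : (1 : ℝ) / (k + 1) ≤ 1 / (b + 1) := by gcongr
    have h3 : ENNReal.ofReal ε < ENNReal.ofReal (r ^ (-γ)) * kernelAverage μ x r :=
      hsub ⟨hr.1, by linarith [hr.2]⟩
    exact (ENNReal.ofReal_le_ofReal (by linarith)).trans h3.le
  refine (packDimMeasure_le_uMDim isClosed_closure.measurableSet
    ((pos_iff_ne_zero.2 hk).trans_le (measure_mono subset_closure))).trans ?_
  exact uMDim_closure_le_of_le_kernelAverage hd μ (Nat.cast_nonneg k)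
    (show (0 : ℝ) < 1 / (k + 1) by positivity) (show (0 : ℝ) < 1 / (k + 1) by positivity) hγ hδ
    (fun x hx => hx.1) (fun x hx => hx.2)

open scoped Classical in
theorem stmt15 {n d : ℕ} (hd : 0 < d)
    (μ : Measure ((Fin n → ℝ) × (Fin d → ℝ))) [IsProbabilityMeasure μ] :
    packDimMeasure μ = ENNReal.ofReal (sSup {γ : ℝ |
      ∀ᵐ x ∂μ, Filter.liminf (fun r : ℝ => ENNReal.ofReal (r ^ (-γ)) *
          ∫⁻ p in {p : (Fin n → ℝ) × (Fin d → ℝ) | ‖p.1 - x.1‖ ≤ r},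
            ∏ i, (if p.2 i = x.2 i then 1
              else ENNReal.ofReal (min 1 (r / |p.2 i - x.2 i|))) ∂μ)
        (nhdsWithin 0 (Set.Ioi 0)) = 0}) := by
  change packDimMeasure μ = ENNReal.ofReal (sSup {γ : ℝ | ∀ᵐ x ∂μ,
    liminf (fun r : ℝ => ENNReal.ofReal (r ^ (-γ)) * kernelAverage μ x r) (𝓝[>] 0) = 0})
  set T := {γ : ℝ | ∀ᵐ x ∂μ,
    liminf (fun r : ℝ => ENNReal.ofReal (r ^ (-γ)) * kernelAverage μ x r) (𝓝[>] 0) = 0} with hT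
  have htop := packDimMeasure_lt_top μ
  have hle : ∀ γ ∈ T, γ ≤ (packDimMeasure μ).toReal := by
    intro γ hγ
    refine (ENNReal.ofReal_le_iff_le_toReal htop.ne).1 (ofReal_le_packDimMeasure ?_)
    filter_upwards [(hγ : ∀ᵐ x ∂μ, _)] with x hx
    rw [← nonpos_iff_eq_zero, ← hx]
    exact liminf_le_liminf (Eventually.of_forall fun r =>
      mul_le_mul_right (measure_closedBall_le_kernelAverage μ x r) _)
  refine le_antisymm ?_ (ENNReal.ofReal_le_of_le_toReal
    (Real.sSup_le hle ENNReal.toReal_nonneg))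
  refine le_of_forall_lt fun a ha => ?_
  obtain ⟨γ, -, haγ, hγ⟩ := ENNReal.lt_iff_exists_real_btwn.1 ha
  obtain ⟨γ', -, hγγ', hγ'⟩ := ENNReal.lt_iff_exists_real_btwn.1 hγ
  have hγ0 : 0 < γ := ENNReal.ofReal_pos.1 (pos_of_gt haγ)
  have hlt : γ < γ' := (ENNReal.ofReal_lt_ofReal_iff_of_nonneg hγ0.le).1 hγγ'
  have hmem : γ ∈ T := by
    by_contra hnot
    have := packDimMeasure_le_of_not_ae_liminf_eq_zero hd μ hγ0.le (sub_pos.2 hlt) hnot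
    rw [add_sub_cancel] at this
    exact hγ'.not_ge this
  exact haγ.trans_le (ENNReal.ofReal_le_ofReal (le_csSup ⟨_, hle⟩ hmem))
end

section
/- Let $h\colon\mathbb{R}^n\to\mathbb{R}^d$ be a Borel map and $A\subset\mathbb{R}^n$ an analytic set. Then $\Dim h(A) = \sup\{\Dim\mu_h : \mu \in \mathcal{P}_c(A)\}$, where $\mathcal{P}_c(A)$ is the family of compactly supported Borel probability measures on $A$, $\mu_h = \mu\circ h^{-1}$, and $\Dim$ denotes packing dimension (of sets and measures respectively). -/
open MeasureTheory Filter
open scoped ENNReal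

open Set Topology

section Covering

variable {X : Type*} [PseudoMetricSpace X]

theorem covN_le_card {E : Set X} {r : ℝ} {S : Finset X}
    (hS : E ⊆ ⋃ x ∈ S, Metric.closedBall x r) : covN E r ≤ S.card :=
  sInf_le ⟨S, hS, rfl⟩

theorem exists_finset_card_eq_covN {E : Set X} {r : ℝ} (h : covN E r ≠ ⊤) :
    ∃ S : Finset X, E ⊆ ⋃ x ∈ S, Metric.closedBall x r ∧ (S.card : ℕ∞) = covN E r := by
  have hne : ((fun S : Finset X => (S.card : ℕ∞)) ''
      {S | E ⊆ ⋃ x ∈ S, Metric.closedBall x r}).Nonempty := by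
    by_contra hemp
    rw [Set.not_nonempty_iff_eq_empty] at hemp
    exact h (by rw [covN, hemp, sInf_empty])
  obtain ⟨S, hS, hc⟩ := csInf_mem hne
  exact ⟨S, hS, hc⟩

theorem covN_closure (E : Set X) (r : ℝ) : covN (closure E) r = covN E r := by
  have key : ∀ S : Finset X, closure E ⊆ ⋃ x ∈ S, Metric.closedBall x r ↔
      E ⊆ ⋃ x ∈ S, Metric.closedBall x r := fun S =>
    IsClosed.closure_subset_iff
      (S.finite_toSet.isClosed_biUnion fun _ _ => Metric.isClosed_closedBall)
  simp only [covN, key]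

theorem uMDim_closure (E : Set X) : uMDim (closure E) = uMDim E := by
  simp only [uMDim, covN_closure]

theorem covN_empty (r : ℝ) : covN (∅ : Set X) r = 0 := by
  have : covN (∅ : Set X) r ≤ ((∅ : Finset X).card : ℕ∞) := covN_le_card (empty_subset _)
  simpa using this

theorem uMDim_empty : uMDim (∅ : Set X) = 0 := by
  simp [uMDim, covN_empty]

/-- A set with large covering number contains many separated points. -/
theorem exists_separated_of_le_covN {E : Set X} {r : ℝ} (hr : 0 ≤ r) :
    ∀ {m : ℕ}, (m : ℕ∞) ≤ covN E r → ∃ p : Fin m → X, (∀ i, p i ∈ E) ∧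
      ∀ i j, i ≠ j → r < dist (p i) (p j) := by
  classical
  suffices h : ∀ m : ℕ, (m : ℕ∞) ≤ covN E r → ∃ P : Finset X, P.card = m ∧ (P : Set X) ⊆ E ∧
      ∀ x ∈ P, ∀ y ∈ P, x ≠ y → r < dist x y by
    intro m hm
    obtain ⟨P, hc, hE, hs⟩ := h m hm
    subst hc
    refine ⟨fun i => (P.equivFin.symm i : X), fun i => hE (P.equivFin.symm i).2, fun i j hij =>
      hs _ (P.equivFin.symm i).2 _ (P.equivFin.symm j).2 fun h => hij ?_⟩
    exact P.equivFin.symm.injective (Subtype.ext h)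
  intro m
  induction m with
  | zero => exact fun _ => ⟨∅, by simp⟩
  | succ m ih =>
    intro hm
    obtain ⟨P, hc, hE, hs⟩ := ih (le_trans (by exact_mod_cast m.le_succ) hm)
    have hncov : ¬ E ⊆ ⋃ x ∈ P, Metric.closedBall x r := fun hcov => by
      have h1 := hm.trans (covN_le_card hcov)
      rw [hc] at h1
      have : m + 1 ≤ m := by exact_mod_cast h1
      omega
    obtain ⟨y, hyE, hy⟩ := not_subset.1 hncov
    simp only [mem_iUnion, Metric.mem_closedBall, not_exists, not_le] at hy
    have hyP : y ∉ P := fun h => by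
      have := hy y h
      rw [dist_self] at this
      linarith
    refine ⟨insert y P, by rw [Finset.card_insert_of_notMem hyP, hc], ?_, ?_⟩
    · rw [Finset.coe_insert]
      exact insert_subset hyE hE
    · intro a ha b hb hab
      rcases Finset.mem_insert.1 ha with rfl | ha' <;> rcases Finset.mem_insert.1 hb with rfl | hb'
      · exact absurd rfl hab
      · exact hy b hb'
      · rw [dist_comm]
        exact hy a ha'
      · exact hs a ha' b hb' hab

theorem frequently_rpow_le_covN {E : Set X} {s : ℝ} (hs : 0 ≤ s)
    (h : ENNReal.ofReal s < uMDim E) :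
    ∃ᶠ r in 𝓝[>] (0 : ℝ), 0 < r ∧ ((⌈r ^ (-s)⌉₊ : ℕ) : ℕ∞) ≤ covN E r := by
  have hf := frequently_lt_of_lt_limsup (by isBoundedDefault) h
  have hlt : ∀ᶠ r in 𝓝[>] (0 : ℝ), r ∈ Ioo (0 : ℝ) 1 := Ioo_mem_nhdsGT one_pos
  refine (hf.and_eventually hlt).mono ?_
  rintro r ⟨hr, hr0, hr1⟩
  refine ⟨hr0, ?_⟩
  split_ifs at hr with htop
  · simp [htop]
  · obtain ⟨N, hN⟩ := ENat.ne_top_iff_exists.1 htop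
    rw [← hN] at hr ⊢
    rw [ENat.toNat_natCast] at hr
    have hlog : 0 < Real.log (1 / r) := Real.log_pos (by rw [lt_div_iff₀ hr0]; linarith)
    have h1 : s < Real.log N / Real.log (1 / r) := (ENNReal.ofReal_lt_ofReal_iff_of_nonneg hs).1 hr
    rw [lt_div_iff₀ hlog] at h1
    have hlogN : 0 < Real.log N := lt_of_le_of_lt (by positivity) h1
    have hNpos : (0 : ℝ) < N := by
      rcases Nat.eq_zero_or_pos N with rfl | h0
      · simp at hlogN
      · exact_mod_cast h0
    have h2 : r ^ (-s) ≤ N := by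
      rw [Real.rpow_def_of_pos hr0, ← Real.le_log_iff_exp_le hNpos]
      rw [one_div, Real.log_inv] at h1
      linarith
    exact_mod_cast Nat.ceil_le.2 h2

theorem eventually_covN_le_rpow {E : Set X} {t : ℝ} (h : uMDim E < ENNReal.ofReal t) :
    ∀ᶠ r in 𝓝[>] (0 : ℝ), ∃ S : Finset X, E ⊆ ⋃ x ∈ S, Metric.closedBall x r ∧
      (S.card : ℝ) ≤ r ^ (-t) := by
  have hf := eventually_lt_of_limsup_lt h (by isBoundedDefault)
  have hlt : ∀ᶠ r in 𝓝[>] (0 : ℝ), r ∈ Ioo (0 : ℝ) 1 := Ioo_mem_nhdsGT one_pos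
  filter_upwards [hf, hlt] with r hr hr01
  obtain ⟨hr0, hr1⟩ := hr01
  split_ifs at hr with htop
  · simp at hr
  · obtain ⟨S, hS, hc⟩ := exists_finset_card_eq_covN htop
    refine ⟨S, hS, ?_⟩
    rw [← hc, ENat.toNat_natCast] at hr
    have hlog : 0 < Real.log (1 / r) := Real.log_pos (by rw [lt_div_iff₀ hr0]; linarith)
    have h1 : Real.log S.card / Real.log (1 / r) < t := (ENNReal.ofReal_lt_ofReal_iff'.1 hr).1
    rw [div_lt_iff₀ hlog] at h1
    rcases Nat.eq_zero_or_pos S.card with h0 | h0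
    · rw [h0, Nat.cast_zero]
      positivity
    · rw [Real.rpow_def_of_pos hr0, ← Real.log_le_iff_le_exp (by exact_mod_cast h0)]
      rw [one_div, Real.log_inv] at h1
      linarith

theorem packDim_le_uMDim (E : Set X) : packDim E ≤ uMDim E :=
  (iInf₂_le (fun _ : ℕ => E) (subset_iUnion (fun _ : ℕ => E) 0)).trans (iSup_le fun _ => le_rfl)

theorem packDim_mono {E F : Set X} (h : E ⊆ F) : packDim E ≤ packDim F :=
  le_iInf₂ fun c hc => iInf₂_le c (h.trans hc)

theorem packDim_iUnion_le {ι : Type*} [Countable ι] {E : ι → Set X} {a : ℝ≥0∞}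
    (h : ∀ i, packDim (E i) ≤ a) : packDim (⋃ i, E i) ≤ a := by
  rcases isEmpty_or_nonempty ι with hι | hι
  · rw [iUnion_of_empty]
    exact (packDim_le_uMDim _).trans (by simp [uMDim_empty])
  obtain ⟨e, he⟩ := exists_surjective_nat ι
  refine le_of_forall_gt fun b hab => ?_
  obtain ⟨b', hab', hb'⟩ := exists_between hab
  refine lt_of_le_of_lt ?_ hb'
  have hc : ∀ i, ∃ c : ℕ → Set X, E i ⊆ ⋃ k, c k ∧ ∀ k, uMDim (c k) ≤ b' := fun i => by
    have := (h i).trans_lt hab'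
    simp only [packDim, iInf_lt_iff] at this
    obtain ⟨c, hcov, hlt⟩ := this
    exact ⟨c, hcov, fun k => (le_iSup (fun k => uMDim (c k)) k).trans hlt.le⟩
  choose c hcov hdim using hc
  refine (iInf₂_le (fun n : ℕ => c (e n.unpair.1) n.unpair.2) ?_).trans
    (iSup_le fun n => hdim _ _)
  refine iUnion_subset fun i x hx => ?_
  obtain ⟨n, rfl⟩ := he i
  obtain ⟨k, hk⟩ := mem_iUnion.1 (hcov _ hx)
  exact mem_iUnion.2 ⟨Nat.pair n k, by simpa using hk⟩

/-- The cover defining the packing dimension may be taken to consist of closed sets. -/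
theorem exists_closed_cover_of_packDim_lt {E : Set X} {a : ℝ≥0∞} (h : packDim E < a) :
    ∃ c : ℕ → Set X, E ⊆ ⋃ i, c i ∧ ∀ i, IsClosed (c i) ∧ uMDim (c i) < a := by
  simp only [packDim, iInf_lt_iff] at h
  obtain ⟨c, hcov, hlt⟩ := h
  refine ⟨fun i => closure (c i), hcov.trans (iUnion_mono fun i => subset_closure), fun i =>
    ⟨isClosed_closure, ?_⟩⟩
  rw [uMDim_closure]
  exact (le_iSup (fun k => uMDim (c k)) i).trans_lt hlt

end Covering

theorem packDimMeasure_le_packDim {X : Type*} [PseudoMetricSpace X] [MeasurableSpace X]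
    [OpensMeasurableSpace X] {μ : Measure X} {E : Set X}
    (h : ∀ F, MeasurableSet F → E ⊆ F → 0 < μ F) : packDimMeasure μ ≤ packDim E := by
  refine le_of_forall_gt fun a ha => ?_
  obtain ⟨b, hb, hba⟩ := exists_between ha
  obtain ⟨c, hcov, hc⟩ := exists_closed_cover_of_packDim_lt hb
  have hm : MeasurableSet (⋃ i, c i) := .iUnion fun i => (hc i).1.measurableSet
  refine lt_of_le_of_lt ?_ hba
  refine (iInf₂_le _ hm).trans ((iInf_le _ (h _ hm hcov)).trans ?_)
  exact (iInf₂_le c Subset.rfl).trans (iSup_le fun i => (hc i).2.le)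

theorem le_packDimMeasure {X : Type*} [PseudoMetricSpace X] [MeasurableSpace X]
    {μ : Measure X} {a : ℝ≥0∞}
    (h : ∀ F, IsClosed F → uMDim F < a → μ F = 0) : a ≤ packDimMeasure μ := by
  refine le_iInf₂ fun E _ => le_iInf fun hpos => ?_
  by_contra! hlt
  obtain ⟨c, hcov, hc⟩ := exists_closed_cover_of_packDim_lt hlt
  refine hpos.ne' (measure_mono_null hcov (measure_iUnion_null fun i => ?_))
  exact h _ (hc i).1 (hc i).2

theorem exists_separated_basis_sets {X Y : Type*} [PseudoMetricSpace X] [PseudoMetricSpace Y]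
    {ι : Type*} {B : ι → Set X} (hB : TopologicalSpace.IsTopologicalBasis (range B))
    {g : X → Y} (hg : Continuous g) {U : Set X} (hU : IsOpen U) {s t : ℝ} (ht : 0 ≤ t) (hts : t < s)
    (hdim : ENNReal.ofReal s < uMDim (g '' U)) {ε : ℝ} (hε : 0 < ε) :
    ∃ (ρ : ℝ) (N : ℕ) (v : ℕ → ι), 0 < ρ ∧ ρ < ε ∧ 0 < N ∧ ρ ^ (-t) ≤ ε * N ∧
      (∀ i, closure (B (v i)) ⊆ U ∧ ∃ x, closure (B (v i)) ⊆ Metric.ball x ε) ∧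
      ∀ i < N, ∀ j < N, i ≠ j → ∀ x ∈ closure (B (v i)), ∀ y ∈ closure (B (v j)),
        2 * ρ < dist (g x) (g y) := by
  have hsmall : ∀ᶠ r in 𝓝[>] (0 : ℝ), (8 : ℝ) ^ t * r ^ (s - t) < ε ∧ r < ε := by
    have h1 : Tendsto (fun r : ℝ => (8 : ℝ) ^ t * r ^ (s - t)) (𝓝 0) (𝓝 0) := by
      have := ((Real.continuous_rpow_const (q := s - t) (by linarith)).tendsto 0).const_mul
        ((8 : ℝ) ^ t)
      rwa [Real.zero_rpow (by linarith), mul_zero] at this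
    exact (((h1.eventually_lt_const hε).and (eventually_lt_nhds hε))).filter_mono
      nhdsWithin_le_nhds
  obtain ⟨r, ⟨hr0, hcov⟩, hr1, hrε⟩ :=
    ((frequently_rpow_le_covN (ht.trans hts.le) hdim).and_eventually hsmall).exists
  have hNpos : 0 < ⌈r ^ (-s)⌉₊ := Nat.ceil_pos.2 (Real.rpow_pos_of_pos hr0 _)
  have hNle : r ^ (-s) ≤ ⌈r ^ (-s)⌉₊ := Nat.le_ceil _
  generalize ⌈r ^ (-s)⌉₊ = N at hcov hNpos hNle
  obtain ⟨p, hp, hsep⟩ := exists_separated_of_le_covN hr0.le hcov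
  choose x hxU hxp using hp
  have hv : ∀ i : Fin N, ∃ v : ι, closure (B v) ⊆
      (U ∩ Metric.ball (x i) ε) ∩ g ⁻¹' Metric.ball (p i) (r / 4) := fun i => by
    have hmem : (U ∩ Metric.ball (x i) ε) ∩ g ⁻¹' Metric.ball (p i) (r / 4) ∈ 𝓝 (x i) := by
      refine inter_mem (inter_mem (hU.mem_nhds (hxU i)) (Metric.ball_mem_nhds _ hε))
        (hg.continuousAt.preimage_mem_nhds ?_)
      rw [hxp i]
      exact Metric.ball_mem_nhds _ (by positivity)
    obtain ⟨_, ⟨v, rfl⟩, -, hv⟩ := hB.exists_closure_subset hmem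
    exact ⟨v, hv⟩
  choose v hv using hv
  refine ⟨r / 8, N, fun i => v ⟨i % N, Nat.mod_lt _ hNpos⟩, by positivity, by linarith, hNpos,
    ?_, fun i => ⟨fun y hy => (hv _ hy).1.1, _, fun y hy => (hv _ hy).1.2⟩, ?_⟩
  · have h8 : (r / 8) ^ (-t) = r ^ (-s) * (8 ^ t * r ^ (s - t)) := by
      rw [Real.div_rpow hr0.le (by norm_num), Real.rpow_neg (by norm_num : (0 : ℝ) ≤ 8),
        div_inv_eq_mul, mul_left_comm, ← Real.rpow_add hr0, mul_comm]
      congr 2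
      ring
    rw [h8, mul_comm ε]
    exact mul_le_mul hNle hr1.le (by positivity) (by positivity)
  · intro i hi j hj hij y hy z hz
    have h1 : dist (g y) (p ⟨i % N, _⟩) < r / 4 := (hv _ hy).2
    have h2 : dist (g z) (p ⟨j % N, _⟩) < r / 4 := (hv _ hz).2
    have h3 := hsep ⟨i % N, Nat.mod_lt _ hNpos⟩ ⟨j % N, Nat.mod_lt _ hNpos⟩ (by
      simpa [Nat.mod_eq_of_lt hi, Nat.mod_eq_of_lt hj] using hij)
    have h4 := dist_triangle4 (p ⟨i % N, Nat.mod_lt _ hNpos⟩) (g y) (g z)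
      (p ⟨j % N, Nat.mod_lt _ hNpos⟩)
    rw [dist_comm (p _) (g y)] at h4
    linarith

/-- The index of the piece containing `x` when the unit interval is cut into `N` equal pieces. -/
noncomputable def pieceIndex (N : ℕ) (x : ℝ) : ℕ := ⌊x * N⌋₊ % N

theorem measurable_pieceIndex (N : ℕ) : Measurable (pieceIndex N) :=
  (measurable_from_top (f := fun m : ℕ => m % N)).comp
    (Nat.measurable_floor.comp (measurable_id.mul_const (N : ℝ)))

theorem volume_pieceIndex_eq_le {N : ℕ} (hN : 0 < N) (i : ℕ) :
    (volume.restrict (Ico (0 : ℝ) 1)) {x | pieceIndex N x = i} ≤ ENNReal.ofReal (1 / N) := by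
  have hN' : (0 : ℝ) < N := by exact_mod_cast hN
  have hm : MeasurableSet {x | pieceIndex N x = i} :=
    measurable_pieceIndex N (measurableSet_singleton i)
  rw [Measure.restrict_apply hm]
  have hsub : {x | pieceIndex N x = i} ∩ Ico (0 : ℝ) 1 ⊆ Ico ((i : ℝ) / N) ((i + 1) / N) := by
    rintro x ⟨hx, hx0, hx1⟩
    have hlt : ⌊x * N⌋₊ < N := by
      rw [Nat.floor_lt (by positivity)]
      nlinarith
    rw [mem_ofPred_eq, pieceIndex, Nat.mod_eq_of_lt hlt, Nat.floor_eq_iff (by positivity)] at hx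
    exact ⟨(div_le_iff₀ hN').2 hx.1, (lt_div_iff₀ hN').2 hx.2⟩
  refine (measure_mono hsub).trans ?_
  rw [Real.volume_Ico, ← sub_div, add_sub_cancel_left]

/-- If every nonempty open set has an image of large upper Minkowski dimension, then there is a
probability measure whose image does not charge closed sets of small dimension. -/
theorem exists_measure_of_forall_lt_uMDim {X Y : Type*} [MetricSpace X] [CompleteSpace X]
    [SecondCountableTopology X] [Nonempty X] [MeasurableSpace X] [BorelSpace X]
    [PseudoMetricSpace Y] {g : X → Y} (hg : Continuous g) {s t : ℝ} (ht : 0 ≤ t) (hts : t < s)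
    (hdim : ∀ U : Set X, IsOpen U → U.Nonempty → ENNReal.ofReal s < uMDim (g '' U)) :
    ∃ ν : Measure X, IsProbabilityMeasure ν ∧
      ∀ F : Set Y, IsClosed F → uMDim F < ENNReal.ofReal t → ν (g ⁻¹' F) = 0 := by
  obtain ⟨ι, _, B, hB, hBne⟩ : ∃ (ι : Type _) (_ : Countable ι) (B : ι → Set X),
      TopologicalSpace.IsTopologicalBasis (range B) ∧ ∀ u, (B u).Nonempty := by
    obtain ⟨b, hbc, hbe, hb⟩ := TopologicalSpace.exists_countable_basis X
    exact ⟨b, hbc.to_subtype, Subtype.val, by rwa [Subtype.range_val], fun u =>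
      nonempty_iff_ne_empty.2 fun h => hbe (h ▸ u.2)⟩
  have hBo : ∀ u, IsOpen (B u) := fun u => hB.isOpen (mem_range_self u)
  have hε : ∀ k : ℕ, ∃ ε : ι → NNReal, (∀ u, 0 < ε u) ∧
      ∑' u, (ε u : ℝ≥0∞) < ENNReal.ofReal (1 / ((k : ℝ) + 1)) := fun k =>
    ENNReal.exists_pos_sum_of_countable (by simp; positivity) ι
  choose ε hεpos hεsum using hε
  have hεle : ∀ k u, (ε k u : ℝ) < 1 / ((k : ℝ) + 1) := fun k u => by
    have := (ENNReal.le_tsum u).trans_lt (hεsum k)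
    rwa [ENNReal.ofReal, ENNReal.coe_lt_coe, Real.lt_toNNReal_iff_coe_lt] at this
  have hch := fun (k : ℕ) (u : ι) => exists_separated_basis_sets hB hg (hBo u) ht hts
    (hdim _ (hBo u) (hBne u)) (NNReal.coe_pos.2 (hεpos k u))
  choose ρ N v hρ0 hρε hN hρN hvsub hvsep using hch
  obtain ⟨_, ⟨u₀, rfl⟩, -⟩ :=
    hB.exists_subset_of_mem_open (mem_univ (Classical.arbitrary X)) isOpen_univ
  -- the nested sequence of basis sets attached to a point of the unit interval
  obtain ⟨σ, hσ0, hσ⟩ : ∃ σ : ℕ → ℝ → ι, (∀ x, σ 0 x = u₀) ∧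
      ∀ k x, σ (k + 1) x = v k (σ k x) (pieceIndex (N k (σ k x)) x) :=
    ⟨fun k x => Nat.rec (motive := fun _ => ι) u₀
      (fun k u => v k u (pieceIndex (N k u) x)) k, fun _ => rfl, fun _ _ => rfl⟩
  let _ : MeasurableSpace ι := ⊤
  have : DiscreteMeasurableSpace ι := ⟨fun _ => trivial⟩
  have hσm : ∀ k, Measurable (σ k) := by
    intro k
    induction k with
    | zero =>
      rw [show σ 0 = fun _ => u₀ from funext hσ0]
      exact measurable_const
    | succ k ih =>
      have hF : Measurable fun q : ι × ℝ => v k q.1 (pieceIndex (N k q.1) q.2) := by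
        refine measurable_from_prod_countable_right fun u => ?_
        have hvm : Measurable (v k u) := measurable_from_top
        exact hvm.comp (measurable_pieceIndex (N k u))
      rw [show σ (k + 1) = fun x => v k (σ k x) (pieceIndex (N k (σ k x)) x) from funext (hσ k)]
      exact hF.comp (ih.prodMk measurable_id)
  have hsub1 : ∀ k x, closure (B (σ (k + 1) x)) ⊆ B (σ k x) := fun k x => by
    rw [hσ]
    exact (hvsub k _ _).1
  have hanti : ∀ x, Antitone fun k => (B (σ k x)) := fun x =>
    antitone_nat_of_succ_le fun k => subset_closure.trans (hsub1 k x)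
  choose pt hpt using hBne
  let z : ℕ → ℝ → X := fun k x => pt (σ k x)
  have hz : ∀ k m x, k ≤ m → z m x ∈ (B (σ k x)) := fun k m x hkm =>
    hanti x hkm (hpt _)
  have hzc : ∀ x, CauchySeq fun k => z k x := fun x => by
    refine (cauchySeq_shift 1).1 (cauchySeq_of_le_tendsto_0 (fun k : ℕ => 2 * (1 / ((k : ℝ) + 1)))
      ?_ ?_)
    · intro n m k hn hm
      obtain ⟨c, hc⟩ := (hvsub k (σ k x) (pieceIndex (N k (σ k x)) x)).2
      rw [← hσ] at hc
      have h1 : dist (z (n + 1) x) c < ε k (σ k x) :=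
        hc (subset_closure (hz (k + 1) (n + 1) x (by omega)))
      have h2 : dist (z (m + 1) x) c < ε k (σ k x) :=
        hc (subset_closure (hz (k + 1) (m + 1) x (by omega)))
      have h3 := dist_triangle_right (z (n + 1) x) (z (m + 1) x) c
      have h4 := hεle k (σ k x)
      linarith
    · simpa using (tendsto_one_div_add_atTop_nhds_zero_nat (𝕜 := ℝ)).const_mul 2
  choose ζ hζ using fun x => cauchySeq_tendsto_of_complete (hzc x)
  have hζm : Measurable ζ := by
    refine measurable_of_tendsto_metrizable (f := z) (fun k => ?_) (tendsto_pi_nhds.2 hζ)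
    exact (measurable_from_top (f := pt)).comp (hσm k)
  have hζmem : ∀ k x, ζ x ∈ closure (B (σ k x)) := fun k x =>
    mem_closure_of_tendsto (hζ x) ((eventually_ge_atTop k).mono fun m hm => hz k m x hm)
  let lam : Measure ℝ := volume.restrict (Ico (0 : ℝ) 1)
  have hlam : IsProbabilityMeasure lam := ⟨by simp [lam]⟩
  refine ⟨lam.map ζ, Measure.isProbabilityMeasure_map hζm.aemeasurable, fun F hF hFdim => ?_⟩
  rw [Measure.map_apply hζm (hF.preimage hg).measurableSet]
  obtain ⟨r₀, hr₀, hcov⟩ := mem_nhdsGT_iff_exists_Ioo_subset.1 (eventually_covN_le_rpow hFdim)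
  have hbound : ∀ k : ℕ, 1 / ((k : ℝ) + 1) < r₀ →
      lam (ζ ⁻¹' (g ⁻¹' F)) ≤ ENNReal.ofReal (1 / ((k : ℝ) + 1)) := by
    intro k hk
    have hcover : ζ ⁻¹' (g ⁻¹' F) ⊆ ⋃ u, {x | g (ζ x) ∈ F ∧ σ k x = u} := fun x hx =>
      mem_iUnion.2 ⟨σ k x, hx, rfl⟩
    refine (measure_mono hcover).trans ((measure_iUnion_le _).trans
      (le_trans (ENNReal.tsum_le_tsum fun u => ?_) (hεsum k).le))
    obtain ⟨S, hS, hcard⟩ := hcov ⟨hρ0 k u, ((hρε k u).trans (hεle k u)).trans hk⟩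
    have hcover' : {x | g (ζ x) ∈ F ∧ σ k x = u} ⊆
        ⋃ y ∈ S, {x | g (ζ x) ∈ Metric.closedBall y (ρ k u) ∧ σ k x = u} := by
      rintro x ⟨hx, hxu⟩
      obtain ⟨y, hyS, hy⟩ := mem_iUnion₂.1 (hS hx)
      exact mem_iUnion₂.2 ⟨y, hyS, hy, hxu⟩
    have hball : ∀ y ∈ S, lam {x | g (ζ x) ∈ Metric.closedBall y (ρ k u) ∧ σ k x = u} ≤
        ENNReal.ofReal (1 / N k u) := by
      intro y _
      rcases eq_empty_or_nonempty {x | g (ζ x) ∈ Metric.closedBall y (ρ k u) ∧ σ k x = u} with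
        he | ⟨x₀, hx₀, hx₀u⟩
      · rw [he, measure_empty]
        exact zero_le
      refine (measure_mono ?_).trans (volume_pieceIndex_eq_le (hN k u) (pieceIndex (N k u) x₀))
      rintro x ⟨hx, hxu⟩
      by_contra hne
      have h1 := hζmem (k + 1) x
      have h2 := hζmem (k + 1) x₀
      rw [hσ, hxu] at h1
      rw [hσ, hx₀u] at h2
      have h3 := hvsep k u _ (Nat.mod_lt _ (hN k u)) _ (Nat.mod_lt _ (hN k u)) hne _ h1 _ h2
      have h4 := dist_triangle_right (g (ζ x)) (g (ζ x₀)) y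
      rw [Metric.mem_closedBall] at hx hx₀
      linarith
    refine (measure_mono hcover').trans ((measure_biUnion_finset_le _ _).trans
      ((Finset.sum_le_sum hball).trans ?_))
    have hNpos : (0 : ℝ) < N k u := by exact_mod_cast hN k u
    rw [Finset.sum_const, nsmul_eq_mul, ← ENNReal.ofReal_natCast,
      ← ENNReal.ofReal_mul (by positivity), ← ENNReal.ofReal_coe_nnreal]
    refine ENNReal.ofReal_le_ofReal ?_
    rw [mul_one_div, div_le_iff₀ hNpos]
    exact hcard.trans (hρN k u)
  have hlim : Tendsto (fun k : ℕ => ENNReal.ofReal (1 / ((k : ℝ) + 1))) atTop (𝓝 0) := by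
    simpa using ENNReal.tendsto_ofReal (tendsto_one_div_add_atTop_nhds_zero_nat (𝕜 := ℝ))
  refine le_antisymm (ge_of_tendsto hlim ?_) zero_le
  filter_upwards [(tendsto_one_div_add_atTop_nhds_zero_nat (𝕜 := ℝ)).eventually_lt_const hr₀]
    with k hk using hbound k hk

theorem exists_measure_of_lt_packDim {X Y : Type*} [TopologicalSpace X] [PolishSpace X]
    [MeasurableSpace X] [BorelSpace X] [PseudoMetricSpace Y] {g : X → Y} (hg : Continuous g)
    {s t : ℝ} (ht : 0 ≤ t) (hts : t < s) (hdim : ENNReal.ofReal s < packDim (range g)) :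
    ∃ ν : Measure X, IsProbabilityMeasure ν ∧
      ∀ F : Set Y, IsClosed F → uMDim F < ENNReal.ofReal t → ν (g ⁻¹' F) = 0 := by
  obtain ⟨b, hbc, -, hb⟩ := TopologicalSpace.exists_countable_basis X
  -- the largest open set with image of small packing dimension
  let small := {u : Set X // u ∈ b ∧ packDim (g '' u) ≤ ENNReal.ofReal s}
  have : Countable small := (hbc.mono fun u (hu : u ∈ b ∧ _) => hu.1).to_subtype
  let O : Set X := ⋃ u : small, u.1
  have hO : IsOpen O := isOpen_iUnion fun u => hb.isOpen u.2.1
  have hOdim : packDim (g '' O) ≤ ENNReal.ofReal s := by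
    rw [image_iUnion]
    exact packDim_iUnion_le fun u => u.2.2
  have hbig : ∀ V : Set X, IsOpen V → (V ∩ Oᶜ).Nonempty →
      ENNReal.ofReal s < packDim (g '' (V ∩ Oᶜ)) := by
    rintro V hV ⟨x, hxV, hxO⟩
    by_contra! hle
    obtain ⟨u, hub, hxu, huV⟩ := hb.exists_subset_of_mem_open hxV hV
    refine hxO (mem_iUnion.2 ⟨⟨u, hub, ?_⟩, hxu⟩)
    have hcover : g '' u ⊆ ⋃ c : Bool, bif c then g '' O else g '' (V ∩ Oᶜ) := by
      rintro _ ⟨y, hy, rfl⟩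
      by_cases hyO : y ∈ O
      · exact mem_iUnion.2 ⟨true, y, hyO, rfl⟩
      · exact mem_iUnion.2 ⟨false, y, ⟨huV hy, hyO⟩, rfl⟩
    refine (packDim_mono hcover).trans (packDim_iUnion_le fun c => ?_)
    cases c
    · exact hle
    · exact hOdim
  have hne : (Oᶜ).Nonempty := by
    by_contra hemp
    rw [not_nonempty_iff_eq_empty, compl_empty_iff] at hemp
    rw [hemp, image_univ] at hOdim
    exact hOdim.not_gt hdim
  have hcl : IsClosed Oᶜ := hO.isClosed_compl
  have : Nonempty ↥Oᶜ := hne.to_subtype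
  have : PolishSpace ↥Oᶜ := hcl.polishSpace
  let _ := TopologicalSpace.upgradeIsCompletelyMetrizable ↥Oᶜ
  obtain ⟨ν, hν, hνF⟩ := exists_measure_of_forall_lt_uMDim (X := ↥Oᶜ)
    (hg.comp continuous_subtype_val) ht hts (by
      rintro U hU ⟨x, hx⟩
      obtain ⟨V, hV, rfl⟩ := isOpen_induced_iff.1 hU
      rw [image_comp, Subtype.image_preimage_coe, inter_comm]
      exact (hbig V hV ⟨x, hx, x.2⟩).trans_le (packDim_le_uMDim _))
  refine ⟨ν.map Subtype.val,
    Measure.isProbabilityMeasure_map measurable_subtype_coe.aemeasurable, fun F hF hFt => ?_⟩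
  rw [Measure.map_apply measurable_subtype_coe (hF.preimage hg).measurableSet]
  exact hνF F hF hFt

theorem exists_compact_measure_of_lt_packDim {X Y : Type*} [TopologicalSpace X] [PolishSpace X]
    [MeasurableSpace X] [BorelSpace X] [PseudoMetricSpace Y] {g : X → Y} (hg : Continuous g)
    {s t : ℝ} (ht : 0 ≤ t) (hts : t < s) (hdim : ENNReal.ofReal s < packDim (range g)) :
    ∃ ν : Measure X, IsProbabilityMeasure ν ∧ (∃ K, IsCompact K ∧ ν Kᶜ = 0) ∧
      ∀ F : Set Y, IsClosed F → uMDim F < ENNReal.ofReal t → ν (g ⁻¹' F) = 0 := by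
  obtain ⟨ν, hν, hνF⟩ := exists_measure_of_lt_packDim hg ht hts hdim
  obtain ⟨K, -, hK, hpos⟩ := MeasurableSet.univ.exists_lt_isCompact (μ := ν) (r := 0) (by simp)
  refine ⟨ProbabilityTheory.cond ν K, ProbabilityTheory.cond_isProbabilityMeasure hpos.ne',
    ⟨K, hK, ?_⟩, fun F hF hFt => ?_⟩
  · rw [ProbabilityTheory.cond_apply hK.measurableSet, inter_compl_self, measure_empty, mul_zero]
  · exact ProbabilityTheory.cond_absolutelyContinuous (hνF F hF hFt)

/-- An analytic set is a continuous image of a Polish space on which a given Borel map becomes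
continuous. -/
theorem MeasureTheory.AnalyticSet.exists_polishSpace_continuous_comp {α β : Type*}
    [TopologicalSpace α] [MeasurableSpace α] [BorelSpace α] [TopologicalSpace β]
    [SecondCountableTopology β] [MeasurableSpace β] [OpensMeasurableSpace β] {h : α → β}
    (hh : Measurable h) {A : Set α} (hA : AnalyticSet A) (hne : A.Nonempty) :
    ∃ (X : Type) (_ : TopologicalSpace X) (_ : PolishSpace X) (f : X → α), Continuous f ∧
      Continuous (h ∘ f) ∧ range f = A := by
  rw [AnalyticSet] at hA
  obtain ⟨f, hf, hfA⟩ := hA.resolve_left hne.ne_empty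
  obtain ⟨T, hT, hc, hP⟩ := (hh.comp hf.measurable).exists_continuous
  exact ⟨ℕ → ℕ, T, hP, f, continuous_le_dom hT hf, hc, hfA⟩

theorem stmt17 {n d : ℕ} (h : (Fin n → ℝ) → (Fin d → ℝ)) (hh : Measurable h)
    (A : Set (Fin n → ℝ)) (hA : MeasureTheory.AnalyticSet A) :
    packDim (h '' A) = ⨆ (μ : Measure (Fin n → ℝ)) (_ : IsProbabilityMeasure μ)
      (_ : ∃ K, IsCompact K ∧ K ⊆ A ∧ μ Kᶜ = 0), packDimMeasure (μ.map h) := by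
  apply le_antisymm
  · refine le_of_forall_lt fun a ha => ?_
    obtain ⟨t, hat, htd⟩ := ENNReal.lt_iff_exists_nnreal_btwn.1 ha
    obtain ⟨s, hts, hsd⟩ := ENNReal.lt_iff_exists_nnreal_btwn.1 htd
    have hne : A.Nonempty := by
      rw [nonempty_iff_ne_empty]
      rintro rfl
      rw [image_empty] at ha
      exact ((packDim_le_uMDim _).trans_eq uMDim_empty).not_gt (bot_le.trans_lt ha)
    obtain ⟨X, _, _, f, hf, hg, rfl⟩ := hA.exists_polishSpace_continuous_comp hh hne
    let _ : MeasurableSpace X := borel X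
    have : BorelSpace X := ⟨rfl⟩
    rw [← range_comp, ← ENNReal.ofReal_coe_nnreal] at hsd
    obtain ⟨ν, hν, ⟨K, hK, hνK⟩, hνF⟩ := exists_compact_measure_of_lt_packDim hg t.2
      (NNReal.coe_lt_coe.2 (ENNReal.coe_lt_coe.1 hts)) hsd
    refine lt_of_lt_of_le hat ?_
    refine le_trans ?_ (le_iSup_of_le (ν.map f) (le_iSup₂_of_le
      (Measure.isProbabilityMeasure_map hf.measurable.aemeasurable)
      ⟨f '' K, hK.image hf, image_subset_range _ _, ?_⟩ le_rfl))
    · rw [Measure.map_map hh hf.measurable]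
      refine le_packDimMeasure fun F hF hFt => ?_
      rw [Measure.map_apply hg.measurable hF.measurableSet]
      exact hνF F hF (by rwa [← ENNReal.ofReal_coe_nnreal] at hFt)
    · rw [Measure.map_apply hf.measurable (hK.image hf).measurableSet.compl]
      exact measure_mono_null (fun x hx hxK => hx (mem_image_of_mem f hxK)) hνK
  · refine iSup_le fun μ => iSup₂_le fun hμ ⟨K, hK, hKA, hμK⟩ => ?_
    refine packDimMeasure_le_packDim fun F hF hAF => ?_
    rw [Measure.map_apply hh hF]
    have hKF : K ⊆ h ⁻¹' F := fun x hx => hAF (mem_image_of_mem h (hKA hx))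
    refine lt_of_lt_of_le ?_ (measure_mono hKF)
    rw [(prob_compl_eq_zero_iff hK.measurableSet).1 hμK]
    exact one_pos
end
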